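/- Let R be a Noetherian ring and let p be a prime ideal of R with |R/p|_r = |R|_r. Let M be a finitely generated critical right R-module with |M|_r = |R|_r and Ass(M) = {p}, and let I = r(M). Then either I = p, or there exists a nonzero ideal J of R with J ≠ p, I < J, Jp ≤ I and |R/J|_r < |R|_r. -/

import Mathlib

universe u v

/-- `DevLE α P`: the deviation (in the sense of Gabriel–Rentschler) of the
preordered set `P` exists and is at most the ordinal `α`. -/
def DevLE (α : Ordinal.{u}) (P : Type v) [Preorder P] : Prop :=
  ∀ f : ℕ → P, (∀ n, f (n + 1) ≤ f n) →
    ∃ N : ℕ, ∀ n, N ≤ n →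
      (∀ x y : {z : P // f (n + 1) ≤ z ∧ z ≤ f n}, x ≤ y → y ≤ x) ∨
      ∃ β : Ordinal.{u}, ∃ _ : β < α, DevLE β {z : P // f (n + 1) ≤ z ∧ z ≤ f n}
termination_by α

/-- The Gabriel–Rentschler Krull dimension of the `R`-module `M`. -/
noncomputable def kdim (R : Type u) (M : Type v) [Ring R] [AddCommGroup M] [Module R M] :
    WithBot Ordinal.{v} :=
  letI := Classical.propDecidable
  if Subsingleton M then ⊥
  else ↑(sInf {α : Ordinal.{v} | DevLE α (Submodule R M)})

/-- The right Krull dimension `|R|_r` of the ring `R`. -/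
noncomputable def rKdim (R : Type u) [Ring R] : WithBot Ordinal.{u} := kdim Rᵐᵒᵖ R

/-- The left Krull dimension `|R|_l` of the ring `R`. -/
noncomputable def lKdim (R : Type u) [Ring R] : WithBot Ordinal.{u} := kdim R R

/-- A two-sided ideal, viewed as a right ideal (i.e. an `Rᵐᵒᵖ`-submodule of `R`). -/
def TwoSidedIdeal.rightIdeal {R : Type u} [Ring R] (I : TwoSidedIdeal R) :
    Submodule Rᵐᵒᵖ R where
  carrier := I
  add_mem' := I.add_mem
  zero_mem' := I.zero_mem
  smul_mem' := fun c x hx => I.mul_mem_right x c.unop hx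

/-- A two-sided ideal, viewed as a left ideal. -/
def TwoSidedIdeal.leftIdeal {R : Type u} [Ring R] (I : TwoSidedIdeal R) :
    Submodule R R := TwoSidedIdeal.asIdeal I

/-- The quotient ring of `R` by the two-sided ideal `I`. -/
abbrev TwoSidedIdeal.Quot {R : Type u} [Ring R] (I : TwoSidedIdeal R) : Type u :=
  I.ringCon.Quotient

/-- A prime (two-sided) ideal of a possibly noncommutative ring:  a proper ideal `P`
such that `x R y ⊆ P` implies `x ∈ P` or `y ∈ P`. -/
def IsPrimeTS {R : Type u} [Ring R] (P : TwoSidedIdeal R) : Prop :=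
  P ≠ ⊤ ∧ ∀ x y : R, (∀ r : R, x * r * y ∈ P) → x ∈ P ∨ y ∈ P

/-- A semiprime ideal is an intersection of prime ideals. -/
def IsSemiprimeTS {R : Type u} [Ring R] (I : TwoSidedIdeal R) : Prop :=
  ∃ S : Set (TwoSidedIdeal R), (∀ p ∈ S, IsPrimeTS p) ∧ I = sInf S

/-- The nilradical (prime radical) of a ring: the intersection of all prime ideals. -/
noncomputable def nilradicalTS (R : Type u) [Ring R] : TwoSidedIdeal R :=
  sInf {P : TwoSidedIdeal R | IsPrimeTS P}

/-- `Λ(R)`: the set of prime ideals `p` with `|R/p|_r = |R|_r`. -/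
noncomputable def Lam (R : Type u) [Ring R] : Set (TwoSidedIdeal R) :=
  {p | IsPrimeTS p ∧ rKdim p.Quot = rKdim R}

/-- `Λ'(R)`: the set of prime ideals `q` with `|R/q|_l = |R|_l`. -/
noncomputable def Lam' (R : Type u) [Ring R] : Set (TwoSidedIdeal R) :=
  {p | IsPrimeTS p ∧ lKdim p.Quot = lKdim R}

/-- `A(R)`: the sum of all right ideals `I` of `R` with `|I|_r < |R|_r`. -/
noncomputable def AIdeal (R : Type u) [Ring R] : Submodule Rᵐᵒᵖ R :=
  sSup {I : Submodule Rᵐᵒᵖ R | kdim Rᵐᵒᵖ I < rKdim R}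

/-- `B(R)`: the sum of all left ideals `K` of `R` with `|K|_l < |R|_l`. -/
noncomputable def BIdeal (R : Type u) [Ring R] : Submodule R R :=
  sSup {K : Submodule R R | kdim R K < lKdim R}

/-- A ring is right Krull homogeneous if every nonzero right ideal has right Krull
dimension equal to that of the ring. -/
noncomputable def RightKrullHomogeneous (R : Type u) [Ring R] : Prop :=
  ∀ J : Submodule Rᵐᵒᵖ R, J ≠ ⊥ → kdim Rᵐᵒᵖ J = rKdim R

/-- A ring is left Krull homogeneous if every nonzero left ideal has left Krull
dimension equal to that of the ring. -/
noncomputable def LeftKrullHomogeneous (R : Type u) [Ring R] : Prop :=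
  ∀ J : Submodule R R, J ≠ ⊥ → kdim R J = lKdim R

/-- The two-sided ideal `I` is right weakly ideal invariant: for every right ideal `J`
with `|R/J|_r < |R/I|_r` one has `|I/JI|_r < |R/I|_r`. -/
noncomputable def RightWII (R : Type u) [Ring R] (I : TwoSidedIdeal R) : Prop :=
  ∀ J : Submodule Rᵐᵒᵖ R,
    kdim Rᵐᵒᵖ (R ⧸ J) < kdim Rᵐᵒᵖ (R ⧸ I.rightIdeal) →
    kdim Rᵐᵒᵖ (I.rightIdeal ⧸ (Submodule.comap I.rightIdeal.subtype
      (Submodule.span Rᵐᵒᵖ {x : R | ∃ j ∈ J, ∃ i ∈ I, x = j * i}))) <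
      kdim Rᵐᵒᵖ (R ⧸ I.rightIdeal)

/-- The two-sided ideal `I` is left weakly ideal invariant: for every left ideal `J`
with `|R/J|_l < |R/I|_l` one has `|I/IJ|_l < |R/I|_l`. -/
noncomputable def LeftWII (R : Type u) [Ring R] (I : TwoSidedIdeal R) : Prop :=
  ∀ J : Submodule R R,
    kdim R (R ⧸ J) < kdim R (R ⧸ I.leftIdeal) →
    kdim R (I.leftIdeal ⧸ (Submodule.comap I.leftIdeal.subtype
      (Submodule.span R {x : R | ∃ i ∈ I, ∃ j ∈ J, x = i * j}))) <
      kdim R (R ⧸ I.leftIdeal)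

/-- `C(I)`: the set of elements of `R` whose image in `R/I` is regular. -/
def Creg {R : Type u} [Ring R] (I : TwoSidedIdeal R) : Set R :=
  {c | ∀ x : R, (c * x ∈ I → x ∈ I) ∧ (x * c ∈ I → x ∈ I)}

/-- The ideal `I` is right localizable: `C(I)` satisfies the right Ore condition. -/
def RightLocalizable {R : Type u} [Ring R] (I : TwoSidedIdeal R) : Prop :=
  ∀ c ∈ Creg I, ∀ x : R, ∃ d ∈ Creg I, ∃ y : R, x * d = c * y

/-- The ideal `I` is left localizable: `C(I)` satisfies the left Ore condition. -/
def LeftLocalizable {R : Type u} [Ring R] (I : TwoSidedIdeal R) : Prop :=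
  ∀ c ∈ Creg I, ∀ x : R, ∃ d ∈ Creg I, ∃ y : R, d * x = y * c

/-- A finitely generated module is critical if `|M/M'| < |M|` for every nonzero
submodule `M'` of `M`. -/
noncomputable def IsCritical (R : Type u) (M : Type v) [Ring R] [AddCommGroup M]
    [Module R M] : Prop :=
  ∀ M' : Submodule R M, M' ≠ ⊥ → kdim R (M ⧸ M') < kdim R M

/-- `P` is a prime ideal associated to the right `R`-module `M`:  `M` contains a nonzero
submodule `N'` such that `P` is the annihilator of every nonzero submodule of `N'`. -/
def IsAssPrime {R : Type u} [Ring R] (P : TwoSidedIdeal R) (M : Type v) [AddCommGroup M]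
    [Module Rᵐᵒᵖ M] : Prop :=
  IsPrimeTS P ∧ ∃ N' : Submodule Rᵐᵒᵖ M, N' ≠ ⊥ ∧
    ∀ N'' : Submodule Rᵐᵒᵖ M, N'' ≠ ⊥ → N'' ≤ N' →
      ∀ r : R, (r ∈ P ↔ ∀ x ∈ N'', (MulOpposite.op r) • x = 0)

/-- A ring satisfies the right large condition if `|R/J|_r < |R|_r` for every
essential right ideal `J`. -/
noncomputable def RightLargeCondition (R : Type u) [Ring R] : Prop :=
  ∀ J : Submodule Rᵐᵒᵖ R, (∀ K : Submodule Rᵐᵒᵖ R, K ≠ ⊥ → J ⊓ K ≠ ⊥) →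
    kdim Rᵐᵒᵖ (R ⧸ J) < rKdim R


open MulOpposite

section Deviation

/-- The deviation of `P` is strictly less than `α`; trivial preorders have deviation `-∞`. -/
def DevLT (α : Ordinal.{u}) (P : Type v) [Preorder P] : Prop :=
  (∀ x y : P, x ≤ y → y ≤ x) ∨ ∃ β : Ordinal.{u}, ∃ _ : β < α, DevLE β P

theorem devLE_iff (α : Ordinal.{u}) (P : Type v) [Preorder P] :
    DevLE α P ↔ ∀ f : ℕ → P, (∀ n, f (n + 1) ≤ f n) →
      ∃ N : ℕ, ∀ n, N ≤ n → DevLT α {z : P // f (n + 1) ≤ z ∧ z ≤ f n} := by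
  rw [DevLE]; rfl

theorem DevLT.mono {α β : Ordinal.{u}} (h : α ≤ β) {P : Type v} [Preorder P]
    (hP : DevLT α P) : DevLT β P :=
  hP.imp_right fun ⟨γ, hγ, hd⟩ => ⟨γ, hγ.trans_le h, hd⟩

theorem DevLE.mono {α β : Ordinal.{u}} (h : α ≤ β) {P : Type v} [Preorder P]
    (hP : DevLE α P) : DevLE β P := by
  rw [devLE_iff] at hP ⊢
  intro f hf
  obtain ⟨N, hN⟩ := hP f hf
  exact ⟨N, fun n hn => (hN n hn).mono h⟩

theorem DevLE.of_strict {α : Ordinal.{u}} {P Q : Type v} [Preorder P] [Preorder Q]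
    (φ : P → Q) (hφ : Monotone φ) (hs : ∀ x y, x ≤ y → φ y ≤ φ x → y ≤ x)
    (hQ : DevLE α Q) : DevLE α P := by
  induction α using WellFoundedLT.induction generalizing P Q with
  | _ α ih =>
    rw [devLE_iff] at hQ ⊢
    intro f hf
    obtain ⟨N, hN⟩ := hQ (φ ∘ f) fun n => hφ (hf n)
    refine ⟨N, fun n hn => ?_⟩
    let ψ : {z : P // f (n + 1) ≤ z ∧ z ≤ f n} →
        {z : Q // (φ ∘ f) (n + 1) ≤ z ∧ z ≤ (φ ∘ f) n} :=
      fun z => ⟨φ z.1, hφ z.2.1, hφ z.2.2⟩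
    have hψ : Monotone ψ := fun a b h => hφ h
    have hψs : ∀ x y, x ≤ y → ψ y ≤ ψ x → y ≤ x := fun x y h h' => hs x.1 y.1 h h'
    rcases hN n hn with h | ⟨β, hβ, hd⟩
    · exact Or.inl fun x y hxy => hψs x y hxy (h _ _ (hψ hxy))
    · exact Or.inr ⟨β, hβ, ih β hβ ψ hψ hψs hd⟩

theorem DevLT.of_strict {α : Ordinal.{u}} {P Q : Type v} [Preorder P] [Preorder Q]
    (φ : P → Q) (hφ : Monotone φ) (hs : ∀ x y, x ≤ y → φ y ≤ φ x → y ≤ x)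
    (hQ : DevLT α Q) : DevLT α P := by
  rcases hQ with h | ⟨β, hβ, hd⟩
  · exact Or.inl fun x y hxy => hs x y hxy (h _ _ (hφ hxy))
  · exact Or.inr ⟨β, hβ, hd.of_strict φ hφ hs⟩

theorem DevLE.of_trivial (α : Ordinal.{u}) {P : Type v} [Preorder P]
    (h : ∀ x y : P, x ≤ y → y ≤ x) : DevLE α P := by
  rw [devLE_iff]
  exact fun f _ => ⟨0, fun n _ => Or.inl fun x y hxy => h x.1 y.1 hxy⟩

theorem DevLE.prod {α : Ordinal.{u}} {P Q : Type v} [Preorder P] [Preorder Q]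
    (hP : DevLE α P) (hQ : DevLE α Q) : DevLE α (P × Q) := by
  induction α using WellFoundedLT.induction generalizing P Q with
  | _ α ih =>
    rw [devLE_iff] at hP hQ ⊢
    intro f hf
    obtain ⟨N₁, h₁⟩ := hP (fun n => (f n).1) fun n => (hf n).1
    obtain ⟨N₂, h₂⟩ := hQ (fun n => (f n).2) fun n => (hf n).2
    refine ⟨max N₁ N₂, fun n hn => ?_⟩
    let ψ : {z : P × Q // f (n + 1) ≤ z ∧ z ≤ f n} →
        {z : P // (f (n + 1)).1 ≤ z ∧ z ≤ (f n).1} ×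
        {z : Q // (f (n + 1)).2 ≤ z ∧ z ≤ (f n).2} :=
      fun z => (⟨z.1.1, z.2.1.1, z.2.2.1⟩, ⟨z.1.2, z.2.1.2, z.2.2.2⟩)
    have hψ : Monotone ψ := fun a b h => ⟨h.1, h.2⟩
    have hψs : ∀ x y, x ≤ y → ψ y ≤ ψ x → y ≤ x := fun x y h h' => ⟨h'.1, h'.2⟩
    refine DevLT.of_strict ψ hψ hψs ?_
    rcases h₁ n (le_of_max_le_left hn) with t₁ | ⟨β₁, hβ₁, d₁⟩ <;>
    rcases h₂ n (le_of_max_le_right hn) with t₂ | ⟨β₂, hβ₂, d₂⟩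
    · exact Or.inl fun x y hxy => ⟨t₁ _ _ hxy.1, t₂ _ _ hxy.2⟩
    · exact Or.inr ⟨β₂, hβ₂, ih β₂ hβ₂ (.of_trivial _ t₁) d₂⟩
    · exact Or.inr ⟨β₁, hβ₁, ih β₁ hβ₁ d₁ (.of_trivial _ t₂)⟩
    · exact Or.inr ⟨max β₁ β₂, max_lt hβ₁ hβ₂, ih _ (max_lt hβ₁ hβ₂)
        (d₁.mono (le_max_left _ _)) (d₂.mono (le_max_right _ _))⟩

theorem DevLT.prod {α : Ordinal.{u}} {P Q : Type v} [Preorder P] [Preorder Q]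
    (hP : DevLT α P) (hQ : DevLT α Q) : DevLT α (P × Q) := by
  rcases hP with t₁ | ⟨β₁, hβ₁, d₁⟩ <;> rcases hQ with t₂ | ⟨β₂, hβ₂, d₂⟩
  · exact Or.inl fun x y hxy => ⟨t₁ _ _ hxy.1, t₂ _ _ hxy.2⟩
  · exact Or.inr ⟨β₂, hβ₂, DevLE.prod (.of_trivial _ t₁) d₂⟩
  · exact Or.inr ⟨β₁, hβ₁, DevLE.prod d₁ (.of_trivial _ t₂)⟩
  · exact Or.inr ⟨max β₁ β₂, max_lt hβ₁ hβ₂, DevLE.prod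
      (d₁.mono (le_max_left _ _)) (d₂.mono (le_max_right _ _))⟩

/-- A partial order with the ascending chain condition and a least element has a deviation. -/
theorem exists_devLE (P : Type v) [PartialOrder P] [OrderBot P] [WellFoundedGT P] :
    ∃ α : Ordinal.{v}, DevLE α P := by
  have key : ∀ x : P, ∃ α : Ordinal.{v}, DevLE α {z : P // x ≤ z} := by
    intro x
    induction x using WellFoundedGT.induction with
    | _ x ih =>
      choose! g hg using ih
      refine ⟨Order.succ (⨆ y : P, g y), ?_⟩
      rw [devLE_iff]
      intro f hf
      have hanti : Antitone f := antitone_nat_of_succ_le hf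
      by_cases hx : ∃ N, (f N).1 = x
      · obtain ⟨N, hN⟩ := hx
        refine ⟨N, fun n hn => Or.inl fun a b _ => ?_⟩
        have h1 : b.1.1 ≤ x :=
          le_trans (show b.1.1 ≤ (f N).1 from b.2.2.trans (hanti hn)) hN.le
        exact h1.trans a.1.2
      · push Not at hx
        refine ⟨0, fun n _ => Or.inr ⟨g (f (n + 1)).1, ?_, ?_⟩⟩
        · exact Order.lt_succ_of_le (le_ciSup Ordinal.bddAbove_of_small _)
        · exact DevLE.of_strict (fun z => ⟨z.1.1, z.2.1⟩) (fun a b h => h)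
            (fun a b _ h' => h') (hg _ (lt_of_le_of_ne (f (n + 1)).2 (hx _).symm))
  obtain ⟨α, hα⟩ := key ⊥
  exact ⟨α, hα.of_strict (fun z => ⟨z, bot_le⟩) (fun _ _ h => h) (fun _ _ _ h => h)⟩

end Deviation

section Modules

variable {S : Type u} [Ring S]

/-- The Krull dimension of the module `X` is strictly less than `α`. -/
def KLT (α : Ordinal.{u}) (S : Type u) (X : Type u) [Ring S] [AddCommGroup X] [Module S X] :
    Prop :=
  DevLT α (Submodule S X)

variable {X Y : Type u} [AddCommGroup X] [Module S X] [AddCommGroup Y] [Module S Y]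
  {α : Ordinal.{u}}

theorem DevLE.of_injective (f : X →ₗ[S] Y) (hf : Function.Injective f)
    (h : DevLE α (Submodule S Y)) : DevLE α (Submodule S X) :=
  h.of_strict (Submodule.map f) (fun _ _ => Submodule.map_mono)
    fun _ _ _ => (Submodule.map_le_map_iff_of_injective hf _ _).1

theorem DevLE.of_surjective (f : X →ₗ[S] Y) (hf : Function.Surjective f)
    (h : DevLE α (Submodule S X)) : DevLE α (Submodule S Y) :=
  h.of_strict (Submodule.comap f) (fun _ _ => Submodule.comap_mono)
    fun _ _ _ => (Submodule.comap_le_comap_iff_of_surjective hf).1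

theorem KLT.of_injective (f : X →ₗ[S] Y) (hf : Function.Injective f)
    (h : KLT α S Y) : KLT α S X :=
  DevLT.of_strict (Submodule.map f) (fun _ _ => Submodule.map_mono)
    (fun _ _ _ => (Submodule.map_le_map_iff_of_injective hf _ _).1) h

theorem KLT.of_surjective (f : X →ₗ[S] Y) (hf : Function.Surjective f)
    (h : KLT α S X) : KLT α S Y :=
  DevLT.of_strict (Submodule.comap f) (fun _ _ => Submodule.comap_mono)
    (fun _ _ _ => (Submodule.comap_le_comap_iff_of_surjective hf).1) h

theorem KLT.of_subsingleton [Subsingleton X] : KLT α S X :=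
  Or.inl fun x y _ => (Subsingleton.elim y x).le

theorem KLT.extension (N : Submodule S X) (h₁ : KLT α S N) (h₂ : KLT α S (X ⧸ N)) :
    KLT α S X := by
  refine DevLT.of_strict
    (fun K => (K.comap N.subtype, K.map N.mkQ)) (fun K K' h => Prod.mk_le_mk.2
      ⟨Submodule.comap_mono h, Submodule.map_mono h⟩) ?_ (DevLT.prod h₁ h₂)
  rintro K K' hKK' ⟨hc, hm⟩ x hx
  obtain ⟨y, hy, hxy⟩ := hm (Submodule.mem_map_of_mem hx)
  have hN : x - y ∈ N := by
    rw [← Submodule.Quotient.eq]; exact hxy.symm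
  have : (⟨x - y, hN⟩ : N) ∈ K.comap N.subtype :=
    hc (show x - y ∈ K' from K'.sub_mem hx (hKK' hy))
  have h3 : x - y ∈ K := this
  simpa using K.add_mem h3 hy

theorem KLT.sup (N N' : Submodule S X) (h₁ : KLT α S N) (h₂ : KLT α S N') :
    KLT α S ↥(N ⊔ N') := by
  have hp : KLT α S (N × N') := by
    refine KLT.extension (LinearMap.ker (LinearMap.snd S N N')) ?_ ?_
    · refine h₁.of_injective ((LinearMap.fst S N N').comp (Submodule.subtype _)) ?_
      rintro ⟨⟨a, b⟩, hb⟩ ⟨⟨a', b'⟩, hb'⟩ h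
      simp only [LinearMap.mem_ker, LinearMap.snd_apply] at hb hb'
      simp_all
    · exact h₂.of_injective _
        (LinearMap.quotKerEquivOfSurjective (LinearMap.snd S N N')
          Prod.snd_surjective).injective
  have hr : LinearMap.range (N.subtype.coprod N'.subtype) = N ⊔ N' := by
    rw [LinearMap.range_coprod]; simp
  rw [← hr]
  exact hp.of_surjective (LinearMap.rangeRestrict _) (LinearMap.surjective_rangeRestrict _)

theorem KLT.of_cyclic [IsNoetherian S X] (N : Submodule S X)
    (h : ∀ x ∈ N, KLT α S ↥(Submodule.span S {x})) : KLT α S N := by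
  have hfg : N.FG := IsNoetherian.noetherian N
  revert h
  refine Submodule.fg_induction (motive := fun N _ => (∀ x ∈ N, KLT α S ↥(Submodule.span S {x})) →
    KLT α S N) ?_ ?_ N hfg
  · exact fun x h => h x (Submodule.mem_span_singleton_self x)
  · exact fun N₁ N₂ _ _ h₁ h₂ h => KLT.sup _ _ (h₁ fun x hx => h x (Submodule.mem_sup_left hx))
      (h₂ fun x hx => h x (Submodule.mem_sup_right hx))

theorem KLT.quotient_range (φ : X →ₗ[S] X) (hφ : Function.Injective φ)
    (h : DevLE α (Submodule S X)) : KLT α S (X ⧸ LinearMap.range φ) := by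
  rw [devLE_iff] at h
  obtain ⟨N, hN⟩ := h (fun n => LinearMap.range (φ ^ n)) (fun n => by
    rw [pow_succ]; exact LinearMap.range_comp_le_range _ _)
  have hinj : Function.Injective (φ ^ N) := by
    rw [Module.End.coe_pow]; exact hφ.iterate N
  have hlow (K : Submodule S (X ⧸ LinearMap.range φ)) :
      LinearMap.range (φ ^ (N + 1)) ≤ (K.comap (LinearMap.range φ).mkQ).map (φ ^ N) := by
    rw [pow_succ, Module.End.mul_eq_comp, LinearMap.range_comp]
    refine Submodule.map_mono fun x hx => ?_
    have : (LinearMap.range φ).mkQ x = 0 := by simpa using hx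
    simp [Submodule.mem_comap, this]
  refine DevLT.of_strict (fun K : Submodule S (X ⧸ LinearMap.range φ) =>
    ⟨(K.comap (LinearMap.range φ).mkQ).map (φ ^ N), hlow K, LinearMap.map_le_range⟩)
    (fun K K' h => Submodule.map_mono (Submodule.comap_mono h)) ?_ (hN N le_rfl)
  intro K K' _ h'
  have h' : (K'.comap (LinearMap.range φ).mkQ).map (φ ^ N) ≤
    (K.comap (LinearMap.range φ).mkQ).map (φ ^ N) := h'
  rwa [Submodule.map_le_map_iff_of_injective hinj,
    Submodule.comap_le_comap_iff_of_surjective (Submodule.mkQ_surjective _)] at h'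

theorem kdim_eq_coe [Nontrivial X] [IsNoetherian S X] :
    ∃ α : Ordinal.{u}, kdim S X = α ∧ DevLE α (Submodule S X) := by
  refine ⟨sInf {α : Ordinal.{u} | DevLE α (Submodule S X)}, ?_, ?_⟩
  · rw [kdim, if_neg (not_subsingleton X)]
  · exact csInf_mem (s := {α : Ordinal.{u} | DevLE α (Submodule S X)}) (exists_devLE _)

theorem KLT.of_kdim_lt [IsNoetherian S X] (h : kdim S X < α) : KLT α S X := by
  rcases subsingleton_or_nontrivial X with hX | hX
  · exact KLT.of_subsingleton
  · obtain ⟨β, hβ, hd⟩ := kdim_eq_coe (S := S) (X := X)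
    rw [hβ] at h
    exact Or.inr ⟨β, WithBot.coe_lt_coe.1 h, hd⟩

theorem KLT.kdim_lt (h : KLT α S X) : kdim S X < α := by
  rcases subsingleton_or_nontrivial X with hX | hX
  · rw [kdim, if_pos hX]; exact WithBot.bot_lt_coe _
  · rcases h with h | ⟨β, hβ, hd⟩
    · exact absurd (h ⊥ ⊤ bot_le) (not_le_of_gt bot_lt_top)
    · rw [kdim, if_neg (not_subsingleton X)]
      exact WithBot.coe_lt_coe.2 
        ((csInf_le' (s := {α : Ordinal.{u} | DevLE α (Submodule S X)}) hd).trans_lt hβ)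

end Modules

section RightIdeals

variable {R : Type u} [Ring R] {X : Type u} [AddCommGroup X] [Module Rᵐᵒᵖ X] {α : Ordinal.{u}}

theorem isNoetherian_op_self [IsNoetherianRing Rᵐᵒᵖ] : IsNoetherian Rᵐᵒᵖ R :=
  isNoetherian_of_surjective (LinearMap.toSpanSingleton Rᵐᵒᵖ R 1) <|
    LinearMap.range_eq_top.2 fun x => ⟨op x, by simp⟩

/-- The right module homomorphism `R → X` sending `r` to `x r`. -/
def orbitMap (x : X) : R →ₗ[Rᵐᵒᵖ] X where
  toFun r := op r • x
  map_add' r s := by simp [add_smul]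
  map_smul' c r := by simp [← mul_smul]

@[simp] theorem orbitMap_apply (x : X) (r : R) : orbitMap x r = op r • x := rfl

theorem range_orbitMap (x : X) :
    LinearMap.range (orbitMap (R := R) x) = Submodule.span Rᵐᵒᵖ {x} := by
  ext y
  rw [Submodule.mem_span_singleton]
  exact ⟨fun ⟨r, hr⟩ => ⟨op r, hr⟩, fun ⟨c, hc⟩ => ⟨c.unop, hc⟩⟩

theorem KLT.quotient_mono {E F : Submodule Rᵐᵒᵖ R} (h : E ≤ F) (hE : KLT α Rᵐᵒᵖ (R ⧸ E)) :
    KLT α Rᵐᵒᵖ (R ⧸ F) :=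
  hE.of_surjective (Submodule.factor h) (Submodule.factor_surjective h)

theorem KLT.quotient_comap_orbitMap {Y : Submodule Rᵐᵒᵖ X} (h : KLT α Rᵐᵒᵖ (X ⧸ Y)) (x : X) :
    KLT α Rᵐᵒᵖ (R ⧸ Y.comap (orbitMap x)) := by
  refine h.of_injective (Submodule.mapQ _ Y (orbitMap x) le_rfl) ?_
  rw [← LinearMap.ker_eq_bot, Submodule.mapQ, Submodule.ker_liftQ_eq_bot]
  intro r hr
  exact (Submodule.Quotient.mk_eq_zero Y).1 hr

theorem KLT.span_singleton {E : Submodule Rᵐᵒᵖ R} (h : KLT α Rᵐᵒᵖ (R ⧸ E)) (x : X)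
    (hx : ∀ r ∈ E, op r • x = 0) : KLT α Rᵐᵒᵖ ↥(Submodule.span Rᵐᵒᵖ {x}) := by
  have h1 : E ≤ LinearMap.ker (orbitMap x) := hx
  rw [← range_orbitMap, ← Submodule.range_liftQ E (orbitMap x) h1]
  exact h.of_surjective (LinearMap.rangeRestrict _) (LinearMap.surjective_rangeRestrict _)

theorem KLT.quotient_of_comap [IsNoetherian Rᵐᵒᵖ R] {E F : Submodule Rᵐᵒᵖ R}
    (hE : KLT α Rᵐᵒᵖ (R ⧸ E)) (h : ∀ e ∈ E, KLT α Rᵐᵒᵖ (R ⧸ F.comap (orbitMap e))) :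
    KLT α Rᵐᵒᵖ (R ⧸ F) := by
  refine KLT.extension (E.map F.mkQ) (KLT.of_cyclic _ ?_) ?_
  · rintro _ ⟨e, he, rfl⟩
    refine (h e he).span_singleton _ fun r hr => ?_
    rw [← map_smul]
    simpa using hr
  · refine hE.of_surjective (Submodule.mapQ E _ F.mkQ fun x hx => Submodule.mem_map_of_mem hx) ?_
    intro y
    obtain ⟨y, rfl⟩ := Submodule.mkQ_surjective _ y
    obtain ⟨y, rfl⟩ := Submodule.mkQ_surjective _ y
    exact ⟨E.mkQ y, rfl⟩

theorem KLT.quotient_inf [IsNoetherian Rᵐᵒᵖ R] {E F : Submodule Rᵐᵒᵖ R}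
    (hE : KLT α Rᵐᵒᵖ (R ⧸ E)) (hF : KLT α Rᵐᵒᵖ (R ⧸ F)) : KLT α Rᵐᵒᵖ (R ⧸ E ⊓ F) := by
  refine hE.quotient_of_comap fun e he =>
    (hF.quotient_comap_orbitMap e).quotient_mono fun r hr => ?_
  exact ⟨E.smul_mem (op r) he, hr⟩

/-- If left multiplication by `c` is injective on `D / A`, then `D / (cD + A)` is small. -/
theorem KLT.quotient_mul_image (hα : DevLE α (Submodule Rᵐᵒᵖ R)) {A D : Submodule Rᵐᵒᵖ R}
    (c : R) (hcA : ∀ a ∈ A, c * a ∈ A) (hcD : ∀ d ∈ D, c * d ∈ D)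
    (hinj : ∀ d ∈ D, c * d ∈ A → d ∈ A) {b : R} (hb : b ∈ D) :
    ∃ E : Submodule Rᵐᵒᵖ R, KLT α Rᵐᵒᵖ (R ⧸ E) ∧ ∀ r ∈ E, ∃ d ∈ D, b * r - c * d ∈ A := by
  let mulC : D →ₗ[Rᵐᵒᵖ] D :=
    { toFun := fun d => ⟨c * d, hcD d d.2⟩
      map_add' := fun x y => Subtype.ext (mul_add _ _ _)
      map_smul' := fun r x => Subtype.ext (by simp [mul_assoc]) }
  let A' : Submodule Rᵐᵒᵖ D := A.comap D.subtype
  have hA' : A' ≤ A'.comap mulC := fun x hx => hcA _ hx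
  let φ : (D ⧸ A') →ₗ[Rᵐᵒᵖ] (D ⧸ A') := A'.mapQ A' mulC hA'
  have hφ : Function.Injective φ := by
    rw [← LinearMap.ker_eq_bot]
    simp only [φ]
    rw [Submodule.mapQ, Submodule.ker_liftQ_eq_bot]
    intro x hx
    have : mulC x ∈ A' := by simpa [LinearMap.mem_ker] using hx
    exact hinj x x.2 this
  have hd : DevLE α (Submodule Rᵐᵒᵖ (D ⧸ A')) :=
    (hα.of_injective D.subtype D.subtype_injective).of_surjective A'.mkQ A'.mkQ_surjective
  refine ⟨_, (KLT.quotient_range φ hφ hd).quotient_comap_orbitMap (A'.mkQ ⟨b, hb⟩), ?_⟩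
  rintro r ⟨y, hy⟩
  obtain ⟨d, rfl⟩ := A'.mkQ_surjective y
  refine ⟨d, d.2, ?_⟩
  have h1 : A'.mkQ (mulC d) = A'.mkQ (op r • ⟨b, hb⟩) := hy
  have h2 := (Submodule.Quotient.eq A').1 h1.symm
  exact h2

end RightIdeals

section PrimeIdeals

variable {R : Type u} [Ring R]

theorem mul_mem_of_rightIdeal {E : Submodule Rᵐᵒᵖ R} {x : R} (hx : x ∈ E) (r : R) : x * r ∈ E :=
  E.smul_mem (op r) hx

/-- The right ideal of all `x` with `a x ∈ q`. -/
def rightColon (q : Submodule Rᵐᵒᵖ R) (a : R) : Submodule Rᵐᵒᵖ R := q.comap (orbitMap a)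

@[simp] theorem mem_rightColon {q : Submodule Rᵐᵒᵖ R} {a x : R} :
    x ∈ rightColon q a ↔ a * x ∈ q := Iff.rfl

variable {q : Submodule Rᵐᵒᵖ R}

/-- The left ideal `F` is essential modulo `q`. -/
def EssentialMod (q : Submodule Rᵐᵒᵖ R) (F : Submodule R R) : Prop :=
  ∀ x, x ∉ q → ∃ s : R, s * x ∉ q ∧ s * x ∈ F

theorem EssentialMod.inf {F G : Submodule R R} (hF : EssentialMod q F) (hG : EssentialMod q G) :
    EssentialMod q (F ⊓ G) := by
  intro x hx
  obtain ⟨s, hs, hsF⟩ := hF x hx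
  obtain ⟨t, ht, htG⟩ := hG _ hs
  refine ⟨t * s, by rwa [mul_assoc], ?_⟩
  rw [mul_assoc]
  exact ⟨F.smul_mem t hsF, htG⟩

theorem EssentialMod.mono {F G : Submodule R R} (h : F ≤ G) (hF : EssentialMod q F) :
    EssentialMod q G := fun x hx => (hF x hx).imp fun _ hs => ⟨hs.1, h hs.2⟩

theorem EssentialMod.comap_mul_right {F : Submodule R R} (hqF : ∀ x ∈ q, x ∈ F)
    (hF : EssentialMod q F) (r : R) :
    EssentialMod q (F.comap (LinearMap.toSpanSingleton R R r)) := by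
  intro x hx
  by_cases hxr : x * r ∈ q
  · exact ⟨1, by simpa using hx, by simpa using hqF _ hxr⟩
  · obtain ⟨s, hs, hsF⟩ := hF _ hxr
    refine ⟨s, fun h => hs ?_, ?_⟩
    · rw [← mul_assoc]; exact mul_mem_of_rightIdeal h r
    · simpa [mul_assoc] using hsF

/-- If `c` is left regular modulo `q` then `Rc + q` is essential modulo `q`. -/
theorem essentialMod_of_regular [IsNoetherianRing R] (hql : ∀ r : R, ∀ x ∈ q, r * x ∈ q)
    {c : R} (hc : ∀ x, x * c ∈ q → x ∈ q) {F : Submodule R R} (hcF : c ∈ F)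
    (hqF : ∀ x ∈ q, x ∈ F) : EssentialMod q F := by
  intro x hx
  by_contra hne
  push Not at hne
  let q' : Submodule R R :=
    { carrier := q
      zero_mem' := q.zero_mem
      add_mem' := q.add_mem
      smul_mem' := fun r y hy => hql r y hy }
  have hq' (a : R) : q'.mkQ a = 0 ↔ a ∈ q := by
    rw [Submodule.mkQ_apply]; exact Submodule.Quotient.mk_eq_zero q'
  let ρ : (R ⧸ q') →ₗ[R] (R ⧸ q') := q'.mapQ q' (LinearMap.toSpanSingleton R R c)
    fun y hy => mul_mem_of_rightIdeal (E := q) hy c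
  have hinj : Function.Injective (ρ.coprod (Submodule.span R {q'.mkQ x}).subtype) := by
    rw [injective_iff_map_eq_zero]
    rintro ⟨y, z, hz⟩ hyz
    obtain ⟨a, rfl⟩ := q'.mkQ_surjective y
    obtain ⟨s, rfl⟩ := Submodule.mem_span_singleton.1 hz
    have h1 : q'.mkQ (a * c + s * x) = 0 := hyz
    rw [hq'] at h1
    have h2 : s * x ∈ F := by
      have h3 := F.sub_mem (hqF _ h1) (F.smul_mem a hcF)
      simpa using h3
    have h4 : s * x ∈ q := by
      by_contra h
      exact hne s h h2
    have h5 : a ∈ q := hc _ (by simpa using q.sub_mem h1 h4)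
    rw [Prod.mk_eq_zero]
    refine ⟨(hq' a).2 h5, Subtype.ext ?_⟩
    change s • q'.mkQ x = 0
    rw [← map_smul]
    exact (hq' _).2 h4
  have hsub := IsNoetherian.subsingleton_of_prod_injective _ hinj
  have h0 := Subsingleton.elim
    (⟨q'.mkQ x, Submodule.mem_span_singleton_self _⟩ : Submodule.span R {q'.mkQ x}) 0
  exact hx ((hq' x).1 (congrArg Subtype.val h0))

/-- Left multiplication by a left regular element modulo `q` is injective on `D / A` when every
nonzero subbimodule of `D / A` has left annihilator `q`. -/
theorem mem_of_mul_mem_of_regular [IsNoetherianRing R] [IsNoetherian Rᵐᵒᵖ R]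
    (hql : ∀ r : R, ∀ x ∈ q, r * x ∈ q) (hq1 : (1 : R) ∉ q) {A D : Submodule Rᵐᵒᵖ R}
    (hAl : ∀ r : R, ∀ x ∈ A, r * x ∈ A) (hDl : ∀ r : R, ∀ x ∈ D, r * x ∈ D) (hAD : A ≤ D)
    (hqD : ∀ x ∈ q, ∀ d ∈ D, x * d ∈ A)
    (hmax : ∀ D' : Submodule Rᵐᵒᵖ R, (∀ r : R, ∀ x ∈ D', r * x ∈ D') → A < D' → D' ≤ D →
      ∀ x, (∀ d ∈ D', x * d ∈ A) → x ∈ q)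
    {c : R} (hc : ∀ x, x * c ∈ q → x ∈ q) {d : R} (hd : d ∈ D) (hcd : c * d ∈ A) : d ∈ A := by
  let F : R → Submodule R R := fun b =>
    { carrier := {s | s * b ∈ A}
      zero_mem' := by simp
      add_mem' := fun {x y} hx hy => by
        change (x + y) * b ∈ A
        rw [add_mul]
        exact A.add_mem hx hy
      smul_mem' := fun r x hx => by
        change r * x * b ∈ A
        rw [mul_assoc]
        exact hAl _ _ hx }
  have htop : EssentialMod q (⊤ : Submodule R R) := fun x hx => ⟨1, by simpa using hx, trivial⟩
  let T : Submodule Rᵐᵒᵖ R :=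
    { carrier := {b | b ∈ D ∧ EssentialMod q (F b)}
      zero_mem' := ⟨D.zero_mem, htop.mono fun s _ => show s * 0 ∈ A by simp⟩
      add_mem' := fun {x y} hx hy => ⟨D.add_mem hx.1 hy.1, (hx.2.inf hy.2).mono fun s hs => by
        change s * (x + y) ∈ A
        rw [mul_add]
        exact A.add_mem hs.1 hs.2⟩
      smul_mem' := fun r x hx => ⟨D.smul_mem r hx.1, hx.2.mono fun s hs => by
        change s * (x * r.unop) ∈ A
        rw [← mul_assoc]
        exact mul_mem_of_rightIdeal hs _⟩ }
  have hTl : ∀ r : R, ∀ x ∈ T, r * x ∈ T := fun r x hx => ⟨hDl r x hx.1,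
    (hx.2.comap_mul_right (fun y hy => hqD y hy x hx.1) r).mono fun s hs => by
      have h1 : s * r * x ∈ A := hs
      change s * (r * x) ∈ A
      rwa [← mul_assoc]⟩
  have hAT : A ≤ T := fun a ha => ⟨hAD ha, htop.mono fun s _ => hAl s a ha⟩
  have hfin (s : Finset R) (hs : ∀ t ∈ s, EssentialMod q (F t)) : EssentialMod q (s.inf F) := by
    classical
    induction s using Finset.induction_on with
    | empty => rwa [Finset.inf_empty]
    | insert a s _ ih =>
      rw [Finset.inf_insert]
      exact (hs a (by simp)).inf (ih fun t ht => hs t (by simp [ht]))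
  have hTA : T ≤ A := by
    by_contra hTA
    obtain ⟨s, hs⟩ := IsNoetherian.noetherian T
    have hsT : ∀ t ∈ s, t ∈ T := fun t ht => hs ▸ Submodule.subset_span ht
    obtain ⟨u, hu, huF⟩ := hfin s (fun t ht => (hsT t ht).2) 1 hq1
    rw [mul_one] at hu huF
    refine hu (hmax T hTl (lt_of_le_not_ge hAT hTA) (fun x hx => hx.1) u ?_)
    have h1 : T ≤ rightColon A u := by
      rw [← hs, Submodule.span_le]
      exact fun t ht => (Finset.inf_le (f := F) ht : _ ≤ F t) huF
    exact h1
  exact hTA ⟨hd, essentialMod_of_regular hql hc (F := F d) hcd fun x hx => hqD x hx d hd⟩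

variable [IsNoetherian Rᵐᵒᵖ R]

/-- A right ideal which is nil modulo the prime ideal `q` is contained in `q`. -/
theorem le_of_nil (hql : ∀ r : R, ∀ x ∈ q, r * x ∈ q)
    (hqp : ∀ x y : R, (∀ r : R, x * r * y ∈ q) → x ∈ q ∨ y ∈ q)
    {E : Submodule Rᵐᵒᵖ R} (hE : ∀ e ∈ E, ∃ n : ℕ, e ^ n ∈ q) : E ≤ q := by
  intro e he
  by_contra heq
  obtain ⟨_, ⟨a, ⟨⟨s, rfl⟩, haq⟩, rfl⟩, hmax⟩ := wellFounded_gt.has_min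
    (rightColon q '' {a | (∃ s, a = s * e) ∧ a ∉ q}) ⟨_, e, ⟨⟨1, by simp⟩, heq⟩, rfl⟩
  refine haq (or_self_iff.1 (hqp (s * e) (s * e) fun x => ?_))
  obtain ⟨k, hk⟩ := hE (e * (x * s)) (mul_mem_of_rightIdeal he _)
  have hy : ∃ n, (x * (s * e)) ^ n ∈ q := by
    refine ⟨k + 1, ?_⟩
    have h1 : (x * (s * e)) ^ (k + 1) = x * s * (e * (x * s)) ^ k * e := by
      rw [← mul_assoc, pow_succ, ← mul_assoc (_ ^ k) (x * s) e]
      congr 1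
      exact mul_pow_mul _ _ _
    rw [h1]
    exact mul_mem_of_rightIdeal (hql _ _ hk) _
  classical
  have hspec := Nat.find_spec hy
  have hmin := fun m => Nat.find_min hy (m := m)
  generalize Nat.find hy = n at hspec hmin
  match n, hspec, hmin with
  | 0, h, _ => exact mul_mem_of_rightIdeal (by simpa using mul_mem_of_rightIdeal h (s * e * x)) _
  | 1, h, _ => simpa [mul_assoc] using hql (s * e) _ h
  | n + 2, h, hmin =>
    have hn := hmin (n + 1) (by omega)
    have hle : rightColon q (s * e) ≤ rightColon q ((x * (s * e)) ^ (n + 1)) := by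
      intro z hz
      rw [mem_rightColon, pow_succ, mul_assoc, mul_assoc x]
      exact hql _ _ (hql _ _ hz)
    have hmem : x * (s * e) ∈ rightColon q ((x * (s * e)) ^ (n + 1)) := by
      rw [mem_rightColon, ← pow_succ]; exact h
    have heq' := eq_of_le_of_not_lt hle
      (hmax _ ⟨_, ⟨⟨(x * (s * e)) ^ n * x * s, by simp only [pow_succ, mul_assoc]⟩, hn⟩, rfl⟩)
    rw [← heq', mem_rightColon] at hmem
    simpa [mul_assoc] using hmem

theorem exists_sq_mem_imp (hql : ∀ r : R, ∀ x ∈ q, r * x ∈ q)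
    (hqp : ∀ x y : R, (∀ r : R, x * r * y ∈ q) → x ∈ q ∨ y ∈ q)
    {E : Submodule Rᵐᵒᵖ R} (hE : ¬ E ≤ q) :
    ∃ d ∈ E, d ∉ q ∧ ∀ x, d * (d * x) ∈ q → d * x ∈ q := by
  have h := mt (le_of_nil hql hqp) hE
  push Not at h
  obtain ⟨e, he, hen⟩ := h
  have hmono : Monotone fun n => rightColon q (e ^ n) := monotone_nat_of_le_succ fun n x hx => by
    rw [mem_rightColon, pow_succ', mul_assoc]
    exact hql _ _ hx
  obtain ⟨n, hn⟩ := monotone_stabilizes_iff_noetherian.2 ‹IsNoetherian Rᵐᵒᵖ R›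
    ⟨_, hmono⟩
  refine ⟨e ^ (n + 1), ?_, hen _, fun x hx => ?_⟩
  · rw [pow_succ']; exact mul_mem_of_rightIdeal he _
  · have h1 : x ∈ rightColon q (e ^ (n + 1 + (n + 1))) := by
      rw [mem_rightColon, pow_add, mul_assoc]; exact hx
    have h2 : rightColon q (e ^ n) = rightColon q (e ^ (n + 1 + (n + 1))) := hn _ (by omega)
    have h3 : rightColon q (e ^ n) = rightColon q (e ^ (n + 1)) := hn _ (by omega)
    rw [← h2, h3] at h1
    exact h1

/-- Every right ideal `E` contains an element whose right annihilator modulo the prime `q`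
meets `E` trivially. -/
theorem exists_mem_mul_mem_imp (hql : ∀ r : R, ∀ x ∈ q, r * x ∈ q)
    (hqp : ∀ x y : R, (∀ r : R, x * r * y ∈ q) → x ∈ q ∨ y ∈ q)
    (E : Submodule Rᵐᵒᵖ R) :
    ∃ c ∈ E, ∀ x ∈ E, c * x ∈ q → x ∈ q := by
  obtain ⟨W, ⟨c, hcE, hcc, hcW⟩, hmax⟩ := wellFounded_gt.has_min
    {W : Submodule Rᵐᵒᵖ R | ∃ c ∈ E, (∀ x, c * (c * x) ∈ q → c * x ∈ q) ∧
      ∀ x ∈ W, c * x ∈ q → x ∈ q} ⟨⊥, 0, E.zero_mem, by simp, by simp⟩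
  refine ⟨c, hcE, ?_⟩
  by_contra hne
  have hE' : ¬ E ⊓ rightColon q c ≤ q := fun h => hne fun x hx hcx => h ⟨hx, hcx⟩
  obtain ⟨d, ⟨hdE, hcd⟩, hdq, hdd⟩ := exists_sq_mem_imp hql hqp hE'
  have hcd : c * d ∈ q := hcd
  have key (y : R) (hy : (c + d) * y ∈ q) : c * y ∈ q ∧ d * y ∈ q := by
    have h1 : c * y ∈ q := by
      apply hcc
      have h2 := q.sub_mem (hql c _ hy) (mul_mem_of_rightIdeal hcd y)
      have h3 : c * ((c + d) * y) - c * d * y = c * (c * y) := by noncomm_ring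
      rwa [h3] at h2
    refine ⟨h1, ?_⟩
    have h2 := q.sub_mem hy h1
    have h3 : (c + d) * y - c * y = d * y := by noncomm_ring
    rwa [h3] at h2
  refine hmax (W ⊔ Submodule.span Rᵐᵒᵖ {d}) ⟨c + d, E.add_mem hcE hdE, fun x hx => ?_,
    fun x hx hcx => ?_⟩ ?_
  · obtain ⟨h1, h2⟩ := key _ hx
    have h4 : c * x ∈ q := by
      apply hcc
      have h3 := q.sub_mem h1 (mul_mem_of_rightIdeal hcd x)
      have h5 : c * ((c + d) * x) - c * d * x = c * (c * x) := by noncomm_ring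
      rwa [h5] at h3
    have h6 : d * x ∈ q := by
      apply hdd
      have h3 := q.sub_mem h2 (hql d _ h4)
      have h5 : d * ((c + d) * x) - d * (c * x) = d * (d * x) := by noncomm_ring
      rwa [h5] at h3
    rw [add_mul]
    exact q.add_mem h4 h6
  · obtain ⟨w, hw, v, hv, rfl⟩ := Submodule.mem_sup.1 hx
    obtain ⟨r, rfl⟩ := Submodule.mem_span_singleton.1 hv
    obtain ⟨h1, h2⟩ := key _ hcx
    have hr : r • d = d * r.unop := rfl
    rw [hr] at h1 h2 ⊢
    have hwq : w ∈ q := by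
      apply hcW w hw
      have h3 := q.sub_mem h1 (mul_mem_of_rightIdeal hcd r.unop)
      have h5 : c * (w + d * r.unop) - c * d * r.unop = c * w := by noncomm_ring
      rwa [h5] at h3
    refine q.add_mem hwq (hdd _ ?_)
    have h3 := q.sub_mem h2 (hql d _ hwq)
    have h5 : d * (w + d * r.unop) - d * w = d * (d * r.unop) := by noncomm_ring
    rwa [h5] at h3
  · refine lt_of_le_of_ne le_sup_left fun h => hdq (hcW d ?_ hcd)
    rw [h]
    exact Submodule.mem_sup_right (Submodule.mem_span_singleton_self d)

/-- If `R / q` is not small for a prime ideal `q`, then no nonzero cyclic submodule of `R / q`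
is small. -/
theorem mem_of_klt_rightColon {α : Ordinal.{u}} [IsNoetherianRing R]
    (hql : ∀ r : R, ∀ x ∈ q, r * x ∈ q)
    (hqp : ∀ x y : R, (∀ r : R, x * r * y ∈ q) → x ∈ q ∨ y ∈ q)
    (hq : ¬ KLT α Rᵐᵒᵖ (R ⧸ q)) {x : R} (hx : KLT α Rᵐᵒᵖ (R ⧸ rightColon q x)) : x ∈ q := by
  let T : Submodule R R :=
    { carrier := {y | KLT α Rᵐᵒᵖ (R ⧸ rightColon q y)}
      zero_mem' := by
        refine hx.quotient_mono fun r _ => ?_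
        simp
      add_mem' := fun {a b} ha hb => by
        refine (KLT.quotient_inf ha hb).quotient_mono fun r hr => ?_
        rw [mem_rightColon, add_mul]
        exact q.add_mem hr.1 hr.2
      smul_mem' := fun s y hy => by
        refine KLT.quotient_mono (fun r hr => ?_) hy
        rw [mem_rightColon, smul_eq_mul, mul_assoc]
        exact hql _ _ hr }
  have hfin (s : Finset R) (hs : ∀ t ∈ s, KLT α Rᵐᵒᵖ (R ⧸ rightColon q t)) :
      KLT α Rᵐᵒᵖ (R ⧸ s.inf (rightColon q)) := by
    classical
    induction s using Finset.induction_on with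
    | empty =>
      rw [Finset.inf_empty]
      exact hx.quotient_mono le_top
    | insert a s _ ih =>
      rw [Finset.inf_insert]
      exact KLT.quotient_inf (hs a (by simp)) (ih fun t ht => hs t (by simp [ht]))
  obtain ⟨s, hs⟩ := IsNoetherian.noetherian T
  by_contra hxq
  refine hq ((hfin s fun t ht => ?_).quotient_mono fun r hr => ?_)
  · have : t ∈ T := hs ▸ Submodule.subset_span ht
    exact this
  · refine (hqp x r fun y => ?_).resolve_left hxq
    have hxy : x * y ∈ T :=
      (KLT.quotient_comap_orbitMap hx y).quotient_mono fun z hz => by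
        have h1 : x * (y * z) ∈ q := hz
        rwa [← mul_assoc] at h1
    rw [← hs] at hxy
    generalize x * y = w at hxy
    induction hxy using Submodule.span_induction with
    | mem t ht => exact (Finset.inf_le (f := rightColon q) ht : _ ≤ rightColon q t) hr
    | zero => simp
    | add a b _ _ ha hb => rw [add_mul]; exact q.add_mem ha hb
    | smul c a _ ha => rw [smul_eq_mul, mul_assoc]; exact hql _ _ ha

end PrimeIdeals

section Annihilators

variable {R : Type u} [Ring R] {M : Type u} [AddCommGroup M] [Module Rᵐᵒᵖ M] {α : Ordinal.{u}}

/-- The submodule of elements killed by the left-closed set `D`. -/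
def killedBy (D : Submodule Rᵐᵒᵖ R) (hDl : ∀ r : R, ∀ x ∈ D, r * x ∈ D) : Submodule Rᵐᵒᵖ M where
  carrier := {n | ∀ d ∈ D, op d • n = 0}
  zero_mem' := by simp
  add_mem' := fun {x y} hx hy d hd => by rw [smul_add, hx d hd, hy d hd, add_zero]
  smul_mem' := fun c x hx d hd => by
    rw [← mul_smul]
    exact hx _ (hDl c.unop d hd)

/-- The elements of the right ideal `p` annihilating the submodule `L`. -/
def annIn (p : Submodule Rᵐᵒᵖ R) (L : Submodule Rᵐᵒᵖ M) : Submodule Rᵐᵒᵖ R where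
  carrier := {b | b ∈ p ∧ ∀ m ∈ L, op b • m = 0}
  zero_mem' := ⟨p.zero_mem, by simp⟩
  add_mem' := fun {x y} hx hy => ⟨p.add_mem hx.1 hy.1, fun m hm => by
    rw [op_add, add_smul, hx.2 m hm, hy.2 m hm, add_zero]⟩
  smul_mem' := fun c x hx => ⟨p.smul_mem c hx.1, fun m hm => by
    have h : op (c • x) = c * op x := rfl
    rw [h, mul_smul, hx.2 m hm, smul_zero]⟩

/-- The ideal of all `x` with `x D ⊆ A`, where `D` is closed under left multiplication. -/
def leftColon (A D : Submodule Rᵐᵒᵖ R) (hDl : ∀ r : R, ∀ x ∈ D, r * x ∈ D) :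
    Submodule Rᵐᵒᵖ R where
  carrier := {x | ∀ d ∈ D, x * d ∈ A}
  zero_mem' := by simp
  add_mem' := fun {x y} hx hy d hd => by
    rw [add_mul]
    exact A.add_mem (hx d hd) (hy d hd)
  smul_mem' := fun c x hx d hd => by
    have h := hx _ (hDl c.unop d hd)
    rwa [← mul_assoc] at h

/-- The right ideal of all `x` such that `x p` annihilates `L`. -/
def multiplierIn (p : Submodule Rᵐᵒᵖ R) (hpl : ∀ r : R, ∀ x ∈ p, r * x ∈ p)
    (L : Submodule Rᵐᵒᵖ M) : Submodule Rᵐᵒᵖ R where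
  carrier := {x | ∀ m ∈ L, ∀ y ∈ p, op (x * y) • m = 0}
  zero_mem' := by simp
  add_mem' := fun {a b} ha hb m hm y hy => by
    rw [add_mul, op_add, add_smul, ha m hm y hy, hb m hm y hy, add_zero]
  smul_mem' := fun c x hx m hm y hy => by
    have h := hx m hm _ (hpl c.unop y hy)
    rwa [← mul_assoc] at h

variable [IsNoetherianRing R] [IsNoetherian Rᵐᵒᵖ R]

/-- If `D / A` is a faithful torsion-free `R / q`-module on the left, where `R / q` is not small,
and `A` annihilates `L`, then so does `D`. -/
theorem smul_eq_zero_of_not_klt (hα : DevLE α (Submodule Rᵐᵒᵖ R))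
    (hM : ∀ K : Submodule Rᵐᵒᵖ M, KLT α Rᵐᵒᵖ K → K = ⊥)
    (hMq : ∀ K : Submodule Rᵐᵒᵖ M, K ≠ ⊥ → KLT α Rᵐᵒᵖ (M ⧸ K))
    {q A D : Submodule Rᵐᵒᵖ R} (hql : ∀ r : R, ∀ x ∈ q, r * x ∈ q)
    (hqp : ∀ x y : R, (∀ r : R, x * r * y ∈ q) → x ∈ q ∨ y ∈ q)
    (hq : ¬ KLT α Rᵐᵒᵖ (R ⧸ q))
    (hAl : ∀ r : R, ∀ x ∈ A, r * x ∈ A) (hDl : ∀ r : R, ∀ x ∈ D, r * x ∈ D) (hAD : A ≤ D)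
    (hqD : ∀ x ∈ q, ∀ d ∈ D, x * d ∈ A)
    (hmax : ∀ D' : Submodule Rᵐᵒᵖ R, (∀ r : R, ∀ x ∈ D', r * x ∈ D') → A < D' → D' ≤ D →
      ∀ x, (∀ d ∈ D', x * d ∈ A) → x ∈ q)
    (hDM : killedBy (M := M) D hDl ≠ ⊥) {L : Submodule Rᵐᵒᵖ M}
    (hAL : ∀ m ∈ L, ∀ a ∈ A, op a • m = 0) {m : M} (hm : m ∈ L) {b : R} (hb : b ∈ D) :
    op b • m = 0 := by
  have hq1 : (1 : R) ∉ q := fun h1 => hq <| by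
    have : q = ⊤ := eq_top_iff.2 fun x _ => by simpa using hql x 1 h1
    have : Subsingleton (R ⧸ q) := Submodule.Quotient.subsingleton_iff.2 this
    exact KLT.of_subsingleton
  have hE := (hMq _ hDM).quotient_comap_orbitMap (R := R) m
  set E := (killedBy (M := M) D hDl).comap (orbitMap m) with hEdef
  obtain ⟨c, hcE, hc⟩ := exists_mem_mul_mem_imp hql hqp E
  have hcr : ∀ y, c * y ∈ q → y ∈ q := fun y hy =>
    mem_of_klt_rightColon hql hqp hq <| (hE.quotient_comap_orbitMap y).quotient_mono
      fun r hr => hc (y * r) hr (by rw [← mul_assoc]; exact mul_mem_of_rightIdeal hy r)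
  have hcl : ∀ x, x * c ∈ q → x ∈ q := by
    intro x hx
    obtain ⟨F, hF, hFc⟩ := KLT.quotient_mul_image (A := q) (D := ⊤) hα c (hql c)
      (fun _ _ => trivial) (fun d _ => hcr d) (b := 1) trivial
    refine mem_of_klt_rightColon hql hqp hq (hF.quotient_mono fun r hr => ?_)
    obtain ⟨d, -, hd⟩ := hFc r hr
    have h1 := q.add_mem (hql x _ hd) (mul_mem_of_rightIdeal hx d)
    have h2 : x * (1 * r - c * d) + x * c * d = x * r := by noncomm_ring
    rwa [h2] at h1
  obtain ⟨F, hF, hFc⟩ := KLT.quotient_mul_image hα c (hAl c) (hDl c)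
    (fun d hd hcd => mem_of_mul_mem_of_regular hql hq1 hAl hDl hAD hqD hmax hcl hd hcd) hb
  have hspan := hM _ (hF.span_singleton (op b • m) fun r hr => ?_)
  · simpa using hspan
  · obtain ⟨d, hd, hbd⟩ := hFc r hr
    have h1 : op d • op c • m = 0 := hcE d hd
    have h2 := hAL m hm _ hbd
    rw [op_sub, sub_smul, op_mul, op_mul, mul_smul, mul_smul, h1, sub_zero] at h2
    exact h2

theorem klt_quotient_multiplierIn (hα : DevLE α (Submodule Rᵐᵒᵖ R))
    (hM : ∀ K : Submodule Rᵐᵒᵖ M, KLT α Rᵐᵒᵖ K → K = ⊥)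
    (hMq : ∀ K : Submodule Rᵐᵒᵖ M, K ≠ ⊥ → KLT α Rᵐᵒᵖ (M ⧸ K))
    {p : Submodule Rᵐᵒᵖ R} (hpl : ∀ r : R, ∀ x ∈ p, r * x ∈ p)
    (hpM : killedBy (M := M) p hpl ≠ ⊥) (L : Submodule Rᵐᵒᵖ M) :
    KLT α Rᵐᵒᵖ (R ⧸ multiplierIn p hpl L) := by
  induction hA : annIn p L using WellFoundedGT.induction generalizing L with
  | _ A ih =>
    have hAp : A ≤ p := hA ▸ fun _ hx => hx.1
    have hAL : ∀ m ∈ L, ∀ a ∈ A, op a • m = 0 := by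
      rintro m hm a ha
      rw [← hA] at ha
      exact ha.2 m hm
    have hAl : ∀ r : R, ∀ x ∈ A, r * x ∈ A := by
      intro r x hx
      rw [← hA] at hx ⊢
      refine ⟨hpl r x hx.1, fun m hm => ?_⟩
      rw [op_mul, mul_smul]
      exact hx.2 _ (L.smul_mem _ hm)
    by_cases hpA : p ≤ A
    · have htop : multiplierIn p hpl L = ⊤ :=
        eq_top_iff.2 fun x _ m hm y hy => hAL m hm _ (hAl x y (hpA hy))
      have : Subsingleton (R ⧸ multiplierIn p hpl L) :=
        Submodule.Quotient.subsingleton_iff.2 htop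
      exact KLT.of_subsingleton
    obtain ⟨q, ⟨D', hD'l, hAD', hD'p, rfl⟩, hqmax⟩ := wellFounded_gt.has_min
      {Q : Submodule Rᵐᵒᵖ R | ∃ D', ∃ h : ∀ r : R, ∀ x ∈ D', r * x ∈ D',
        A < D' ∧ D' ≤ p ∧ leftColon A D' h = Q}
      ⟨_, p, hpl, lt_of_le_not_ge hAp hpA, le_rfl, rfl⟩
    set q := leftColon A D' hD'l with hqdef
    have hql : ∀ r : R, ∀ x ∈ q, r * x ∈ q := fun r x hx d hd => by
      rw [mul_assoc]
      exact hAl _ _ (hx d hd)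
    have hmax : ∀ D'' : Submodule Rᵐᵒᵖ R, (∀ r : R, ∀ x ∈ D'', r * x ∈ D'') → A < D'' →
        D'' ≤ p → (∀ x ∈ q, ∀ d ∈ D'', x * d ∈ A) → ∀ x, (∀ d ∈ D'', x * d ∈ A) → x ∈ q := by
      intro D'' hl hlt hle hq x hx
      rw [eq_of_le_of_not_lt (show q ≤ leftColon A D'' hl from hq)
        (hqmax _ ⟨D'', hl, hlt, hle, rfl⟩)]
      exact hx
    have hqp : ∀ x y : R, (∀ r : R, x * r * y ∈ q) → x ∈ q ∨ y ∈ q := by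
      intro x y hxy
      by_contra! hne
      obtain ⟨hx, hy⟩ := hne
      have hy' : ∃ d ∈ D', y * d ∉ A := by
        by_contra! h
        exact hy h
      obtain ⟨d, hd, hyd⟩ := hy'
      let D'' : Submodule Rᵐᵒᵖ R :=
        { carrier := {d | d ∈ D' ∧ ∀ r : R, x * (r * d) ∈ A}
          zero_mem' := ⟨D'.zero_mem, by simp⟩
          add_mem' := fun {a b} ha hb => ⟨D'.add_mem ha.1 hb.1, fun r => by
            rw [mul_add, mul_add]
            exact A.add_mem (ha.2 r) (hb.2 r)⟩
          smul_mem' := fun c a ha => ⟨D'.smul_mem c ha.1, fun r => by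
            have h := mul_mem_of_rightIdeal (ha.2 r) c.unop
            rwa [mul_assoc, mul_assoc] at h⟩ }
      have hydD : y * d ∈ D'' := ⟨hD'l _ _ hd, fun r => by
        have h := hxy r d hd
        rwa [mul_assoc, mul_assoc] at h⟩
      refine hx (hmax D'' (fun r z hz => ⟨hD'l r z hz.1, fun s => ?_⟩)
        (lt_of_le_not_ge (fun a ha => ⟨hAD'.le ha, fun r => hAl _ _ (hAl _ _ ha)⟩)
          fun h => hyd (h hydD)) (fun z hz => hD'p hz.1) (fun z hz e he => hz e he.1) x
        fun e he => ?_)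
      · rw [← mul_assoc s]
        exact hz.2 _
      · simpa using he.2 1
    let D : Submodule Rᵐᵒᵖ R :=
      { carrier := {b | b ∈ p ∧ ∀ x ∈ q, x * b ∈ A}
        zero_mem' := ⟨p.zero_mem, by simp⟩
        add_mem' := fun {a b} ha hb => ⟨p.add_mem ha.1 hb.1, fun x hx => by
          rw [mul_add]
          exact A.add_mem (ha.2 x hx) (hb.2 x hx)⟩
        smul_mem' := fun c a ha => ⟨p.smul_mem c ha.1, fun x hx => by
          have h := mul_mem_of_rightIdeal (ha.2 x hx) c.unop
          rwa [mul_assoc] at h⟩ }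
    have hDl : ∀ r : R, ∀ x ∈ D, r * x ∈ D := fun r x hx => ⟨hpl r x hx.1, fun y hy => by
      rw [← mul_assoc]
      exact hx.2 _ (mul_mem_of_rightIdeal hy r)⟩
    have hAD : A < D := hAD'.trans_le fun d hd => ⟨hD'p hd, fun x hx => hx d hd⟩
    have hqD : ∀ x ∈ q, ∀ d ∈ D, x * d ∈ A := fun x hx d hd => hd.2 x hx
    have hq : KLT α Rᵐᵒᵖ (R ⧸ q) := by
      by_contra hq
      refine hAD.not_ge fun b hb => ?_
      rw [← hA]
      refine ⟨hb.1, fun m hm => smul_eq_zero_of_not_klt hα hM hMq hql hqp hq hAl hDl hAD.le hqD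
        (fun D'' hl hlt hle => hmax D'' hl hlt (hle.trans fun z hz => hz.1)
          fun x hx d hd => hqD x hx d (hle hd)) (fun h => hpM ?_) hAL hm hb⟩
      exact eq_bot_iff.2 (h ▸ fun n hn d hd => hn d hd.1)
    let L' : Submodule Rᵐᵒᵖ M := Submodule.span Rᵐᵒᵖ {n | ∃ x ∈ q, ∃ m ∈ L, op x • m = n}
    have hL'D : L' ≤ killedBy D hDl := by
      rw [Submodule.span_le]
      rintro _ ⟨x, hx, m, hm, rfl⟩ d hd
      rw [← mul_smul, ← op_mul]
      exact hAL m hm _ (hqD x hx d hd)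
    have hlt : A < annIn p L' := hAD.trans_le fun d hd => ⟨hd.1, fun m hm => hL'D hm d hd⟩
    refine hq.quotient_of_comap fun e he => (ih _ hlt L' rfl).quotient_mono ?_
    intro x hx m hm y hy
    have h := hx _ (Submodule.subset_span ⟨e, he, m, hm, rfl⟩) y hy
    rwa [← mul_smul, ← op_mul, ← mul_assoc] at h

end Annihilators

/-- If `R / J` is small as a right `R`-module, then it is small over itself. -/
theorem KLT.quot {R : Type u} [Ring R] {α : Ordinal.{u}} {J : TwoSidedIdeal R}
    (h : KLT α Rᵐᵒᵖ (R ⧸ J.rightIdeal)) : KLT α J.Quotᵐᵒᵖ J.Quot := by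
  let π : R →+* J.Quot := J.ringCon.mk'
  have hπ : Function.Surjective π := J.ringCon.mk'_surjective
  let C (K : Submodule J.Quotᵐᵒᵖ J.Quot) : Submodule Rᵐᵒᵖ R :=
    { carrier := {r | π r ∈ K}
      zero_mem' := by
        change π 0 ∈ K
        rw [map_zero]
        exact K.zero_mem
      add_mem' := fun {a b} ha hb => by
        change π (a + b) ∈ K
        rw [map_add]
        exact K.add_mem ha hb
      smul_mem' := fun c a ha => by
        change π (a * c.unop) ∈ K
        rw [map_mul]
        exact K.smul_mem (op (π c.unop)) ha }
  refine DevLT.of_strict (fun K => (C K).map J.rightIdeal.mkQ)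
    (fun K K' hK => Submodule.map_mono fun r hr => hK hr) (fun K K' _ hK z hz => ?_) h
  obtain ⟨r, rfl⟩ := hπ z
  obtain ⟨s, hs, hsr⟩ := hK (Submodule.mem_map_of_mem (f := J.rightIdeal.mkQ)
    (show r ∈ C K' from hz))
  have h1 : s - r ∈ J := (Submodule.Quotient.eq J.rightIdeal).1 hsr
  have h2 : π s = π r := (RingCon.eq J.ringCon).2 (TwoSidedIdeal.rel_iff J _ _ |>.2 h1)
  rw [← h2]
  exact hs

/-- Let `R` be Noetherian, `p` a prime with `|R/p|_r = |R|_r`, and `M` a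
finitely generated critical right `R`-module with `|M|_r = |R|_r` and `Ass(M) = {p}`.
If `I = r(M)` then either `I = p`, or there is a nonzero ideal `J ≠ p` with `I < J`,
`Jp ≤ I` and `|R/J|_r < |R|_r`. -/
theorem statement_8 (R : Type u) [Ring R] [IsNoetherianRing R] [IsNoetherianRing Rᵐᵒᵖ]
    (p : TwoSidedIdeal R) (hp : IsPrimeTS p) (hpr : rKdim p.Quot = rKdim R)
    (M : Type u) [AddCommGroup M] [Module Rᵐᵒᵖ M] [Module.Finite Rᵐᵒᵖ M]
    (hcrit : IsCritical Rᵐᵒᵖ M) (hMdim : kdim Rᵐᵒᵖ M = rKdim R)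
    (hass : {P : TwoSidedIdeal R | IsAssPrime P M} = {p})
    (I : TwoSidedIdeal R) (hI : ∀ r : R, r ∈ I ↔ ∀ x : M, (MulOpposite.op r) • x = 0) :
    I = p ∨
    ∃ J : TwoSidedIdeal R, J ≠ ⊥ ∧ J ≠ p ∧ I < J ∧
      (∀ x ∈ J, ∀ y ∈ p, x * y ∈ I) ∧ rKdim J.Quot < rKdim R := by
  right
  have hnoeth : IsNoetherian Rᵐᵒᵖ R := isNoetherian_op_self
  have hnoethM : IsNoetherian Rᵐᵒᵖ M := inferInstance
  have hnt : Nontrivial R := by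
    by_contra h
    rw [not_nontrivial_iff_subsingleton] at h
    exact hp.1 (TwoSidedIdeal.ext fun x => by simp [Subsingleton.elim x 0])
  obtain ⟨α, hRα, hα⟩ := kdim_eq_coe (S := Rᵐᵒᵖ) (X := R)
  have hRα' : rKdim R = α := hRα
  have hMq : ∀ K : Submodule Rᵐᵒᵖ M, K ≠ ⊥ → KLT α Rᵐᵒᵖ (M ⧸ K) := fun K hK =>
    KLT.of_kdim_lt (by rw [← hRα', ← hMdim]; exact hcrit K hK)
  have hMα : ¬ KLT α Rᵐᵒᵖ M := fun h => absurd h.kdim_lt (by rw [hMdim, hRα']; exact lt_irrefl _)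
  have hM : ∀ K : Submodule Rᵐᵒᵖ M, KLT α Rᵐᵒᵖ K → K = ⊥ := fun K hK => by
    by_contra hne
    exact hMα (KLT.extension K hK (hMq K hne))
  have hpl : ∀ r : R, ∀ x ∈ p.rightIdeal, r * x ∈ p.rightIdeal := fun r x hx =>
    p.mul_mem_left r x hx
  have hpM : killedBy (M := M) p.rightIdeal hpl ≠ ⊥ := by
    have hpass : p ∈ {P : TwoSidedIdeal R | IsAssPrime P M} := hass ▸ rfl
    obtain ⟨-, N, hN, hNp⟩ := hpass
    exact ne_bot_of_le_ne_bot hN fun n hn d hd => (hNp N hN le_rfl d).1 hd n hn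
  have hklt : KLT α Rᵐᵒᵖ (R ⧸ multiplierIn (M := M) p.rightIdeal hpl ⊤) :=
    klt_quotient_multiplierIn hα hM hMq hpl hpM ⊤
  let J : TwoSidedIdeal R := TwoSidedIdeal.mk' {x | ∀ m : M, ∀ y ∈ p, op (x * y) • m = 0}
    (by simp) (fun {a b} ha hb m y hy => by
      rw [add_mul, op_add, add_smul, ha m y hy, hb m y hy, add_zero])
    (fun {a} ha m y hy => by rw [neg_mul, op_neg, neg_smul, ha m y hy, neg_zero])
    (fun {a b} hb m y hy => by
      rw [mul_assoc, op_mul, mul_smul]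
      exact hb _ y hy)
    (fun {a b} ha m y hy => by
      rw [mul_assoc]
      exact ha m _ (p.mul_mem_left b y hy))
  have hJ (x : R) : x ∈ J ↔ ∀ m : M, ∀ y ∈ p, op (x * y) • m = 0 :=
    TwoSidedIdeal.mem_mk' _ _ _ _ _ _ _
  have hIJ : I ≤ J := fun x hx => (hJ x).2 fun m y hy => (hI _).1 (I.mul_mem_right x y hx) m
  have hJα : KLT α Rᵐᵒᵖ (R ⧸ J.rightIdeal) :=
    hklt.quotient_mono fun x (hx : x ∈ multiplierIn _ hpl ⊤) =>
      (hJ x).2 fun m y hy => hx m trivial y hy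
  have hJdim : rKdim J.Quot < rKdim R := hRα' ▸ hJα.quot.kdim_lt
  have hIJne : I ≠ J := by
    rintro rfl
    refine hMα (KLT.of_surjective (⊤ : Submodule Rᵐᵒᵖ M).subtype (fun x => ⟨⟨x, trivial⟩, rfl⟩) ?_)
    exact KLT.of_cyclic _ fun m _ => hJα.span_singleton m fun r hr => (hI r).1 hr m
  have hlt : I < J := lt_of_le_of_ne hIJ hIJne
  refine ⟨J, (bot_le.trans_lt hlt).ne', ?_, hlt, fun x hx y hy => (hI _).2 fun m =>
    (hJ x).1 hx m y hy, hJdim⟩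
  intro h
  rw [h, hpr] at hJdim
  exact lt_irrefl _ hJdim
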